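/- The operator norms of the commutators of the position operator X with B and with C equal 1, i.e. ‖[X, B]‖ = 1 and ‖[X, C]‖ = 1; moreover, for every t ∈ [0,1] with r = √(1−t²), ‖[X, rt·B + t²·C]‖ = t. -/

import Mathlib

noncomputable section

abbrev Hqw : Type := lp (fun _ : ℤ => ℂ) 2
abbrev Op : Type := Hqw →L[ℂ] Hqw

noncomputable def δ (j : ℤ) : Hqw := lp.single 2 j 1

def coord (ψ : Hqw) (i : ℤ) : ℂ := ψ i

/-- `B δ_j = δ_{j-1} - δ_{j+1}`. -/
def IsB (B : Op) : Prop := ∀ j : ℤ, B (δ j) = δ (j - 1) - δ (j + 1)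

/-- `C δ_{2j} = δ_{2j+2}`, `C δ_{2j+1} = δ_{2j-1}`. -/
def IsC (C : Op) : Prop :=
  ∀ j : ℤ, C (δ (2 * j)) = δ (2 * j + 2) ∧ C (δ (2 * j + 1)) = δ (2 * j - 1)

/-- the position sequence: `x_{2j} = x_{2j+1} = |j|`. -/
def IsPos (x : ℤ → ℝ) : Prop :=
  ∀ j : ℤ, x (2 * j) = |(j : ℝ)| ∧ x (2 * j + 1) = |(j : ℝ)|

/-- `K` is the commutator `[X, A]`, i.e. `⟨δ_i, K δ_j⟩ = (x_i - x_j) ⟨δ_i, A δ_j⟩`. -/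
def IsXComm (x : ℤ → ℝ) (A K : Op) : Prop :=
  ∀ i j : ℤ, coord (K (δ j)) i = ((x i - x j : ℝ) : ℂ) * coord (A (δ j)) i

/-- a local field: a diagonal unitary `D δ_j = e^{iθ_j} δ_j`. -/
def IsLocalField (D : Op) : Prop :=
  ∃ θ : ℤ → ℝ, ∀ j : ℤ, D (δ j) = Complex.exp ((θ j : ℂ) * Complex.I) • δ j

/-- `U_t = r² I + r t B + t² C` with `r = √(1 - t²)`. -/
def Ut (t : ℝ) (B C : Op) : Op :=
  (((Real.sqrt (1 - t ^ 2)) ^ 2 : ℝ) : ℂ) • (1 : Op) +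
    ((Real.sqrt (1 - t ^ 2) * t : ℝ) : ℂ) • B + ((t ^ 2 : ℝ) : ℂ) • C

/-- `⟨X⟩_ψ = Σ_j x_j |⟨δ_j, ψ⟩|²`. -/
def Xexp (x : ℤ → ℝ) (ψ : Hqw) : ℝ := ∑' j : ℤ, x j * ‖coord ψ j‖ ^ 2

/-- a unit vector supported on `span{δ₀, δ₁}`. -/
def IsInit (Ψ : Hqw) : Prop := ‖Ψ‖ = 1 ∧ ∃ a b : ℂ, Ψ = a • δ 0 + b • δ 1

/-- `α = e^{2πik/n}` with `k ∈ ℤ⁺`, `gcd(k,n) = 1`, `α ≠ 1`. -/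
def IsAdmissible (n : ℕ) (α : ℂ) : Prop :=
  α ≠ 1 ∧ ∃ k : ℕ, 0 < k ∧ Nat.gcd k n = 1 ∧
    α = Complex.exp (((2 * Real.pi * k / n : ℝ) : ℂ) * Complex.I)

/-- the `n`-periodic field `D_n δ_j = α^j δ_j`. -/
def IsDn (α : ℂ) (D : Op) : Prop := ∀ j : ℤ, D (δ j) = α ^ j • δ j

/-- `B^{(j)} = D_n^j B D_n^{-j}`, explicitly `B^{(j)} δ_i = α^{-j} δ_{i-1} - α^{j} δ_{i+1}`. -/
def IsBj (α : ℂ) (j : ℤ) (Bj : Op) : Prop :=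
  ∀ i : ℤ, Bj (δ i) = α ^ (-j) • δ (i - 1) - α ^ j • δ (i + 1)

/-- `C^{(j)} = D_n^j C D_n^{-j}`, explicitly `C^{(j)} δ_{2i} = α^{2j} δ_{2i+2}`,
`C^{(j)} δ_{2i+1} = α^{-2j} δ_{2i-1}`. -/
def IsCj (α : ℂ) (j : ℤ) (Cj : Op) : Prop :=
  ∀ i : ℤ, Cj (δ (2 * i)) = α ^ (2 * j) • δ (2 * i + 2) ∧
    Cj (δ (2 * i + 1)) = α ^ (-(2 * j)) • δ (2 * i - 1)

-- the elementary symmetric polynomial of operators `S^{ℓ,m}_{[a, n-1]}`: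
-- sum over `a ≤ j₁ < … < j_ℓ ≤ n-1` and `η ∈ {0,1}^ℓ` with `|η| = m` of the ordered
-- products `A_{η₁}^{(j₁)} ⋯ A_{η_ℓ}^{(j_ℓ)}`, where `A_1 = C`, `A_0 = B`.
open Classical in
noncomputable def Sop (Bf Cf : ℤ → Op) (a n ℓ m : ℕ) : Op :=
  ∑ p : (Fin ℓ → Fin n) × (Fin ℓ → Bool),
    if StrictMono p.1 ∧ (∀ k, a ≤ (p.1 k : ℕ)) ∧
        (Finset.univ.filter fun k => p.2 k = true).card = m then
      (List.ofFn fun k : Fin ℓ =>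
        if p.2 k = true then Cf ((p.1 k : ℕ) : ℤ) else Bf ((p.1 k : ℕ) : ℤ)).prod
    else 0

theorem coord_δ (j i : ℤ) : coord (δ j) i = if i = j then 1 else 0 := by
  unfold coord δ
  rw [lp.single_apply]
  split_ifs with h
  · subst h; simp
  · simp [h]

theorem inner_δ (i : ℤ) (ψ : Hqw) : inner ℂ (δ i) ψ = coord ψ i := by
  unfold coord δ
  rw [lp.inner_single_left]
  simp

theorem coord_add' (φ ψ : Hqw) (i : ℤ) : coord (φ + ψ) i = coord φ i + coord ψ i := rfl

theorem coord_sub' (φ ψ : Hqw) (i : ℤ) : coord (φ - ψ) i = coord φ i - coord ψ i := rfl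

theorem coord_smul' (c : ℂ) (ψ : Hqw) (i : ℤ) : coord (c • ψ) i = c * coord ψ i := rfl

theorem op_ext (S T : Op) (h : ∀ i j : ℤ, coord (S (δ j)) i = coord (T (δ j)) i) : S = T := by
  have h2 : ∀ j, S (δ j) = T (δ j) := fun j => lp.ext (funext fun i => h i j)
  ext1 ψ
  have hs : HasSum (fun i : ℤ => (lp.single 2 i (ψ i) : Hqw)) ψ :=
    lp.hasSum_single (by norm_num) ψ
  have hd : ∀ i : ℤ, (lp.single 2 i (ψ i) : Hqw) = (ψ i) • δ i := by
    intro i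
    unfold δ
    rw [← lp.single_smul]
    simp
  have h3 := S.hasSum hs
  have h4 := T.hasSum hs
  have h5 : (fun i : ℤ => S (lp.single 2 i (ψ i) : Hqw)) =
      (fun i : ℤ => T (lp.single 2 i (ψ i) : Hqw)) := by
    funext i
    rw [hd i, map_smul, map_smul, h2]
  rw [h5] at h3
  exact h3.unique h4

theorem s_sq {x : ℤ → ℝ} (hx : IsPos x) (j : ℤ) :
    (x (2 * j + 2) - x (2 * j + 1)) ^ 2 = 1 := by
  have h1 : x (2 * j + 2) = |((j + 1 : ℤ) : ℝ)| := by
    rw [← (hx (j + 1)).1]; congr 1; ring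
  rw [h1, (hx j).2]
  rcases le_or_gt 0 j with h | h
  · have : (0 : ℝ) ≤ j := by exact_mod_cast h
    push_cast
    rw [abs_of_nonneg this, abs_of_nonneg (by linarith)]
    ring
  · have : (j : ℝ) + 1 ≤ 0 := by exact_mod_cast h
    push_cast
    rw [abs_of_nonpos this, abs_of_nonpos (by linarith)]
    ring

theorem key {B C : Op} (hB : IsB B) (hC : IsC C) {x : ℤ → ℝ} (hx : IsPos x)
    (p q : ℝ) (K : Op) (hK : IsXComm x ((p : ℂ) • B + (q : ℂ) • C) K) :
    ‖K‖ ^ 2 = p ^ 2 + q ^ 2 := by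
  obtain ⟨s, hs⟩ : ∃ s : ℤ → ℝ, ∀ j, s j = x (2 * j + 2) - x (2 * j + 1) := ⟨_, fun _ => rfl⟩
  have hs2 : ∀ j, ((s j : ℝ) : ℂ) ^ 2 = 1 := fun j => by
    have := s_sq hx j
    rw [← hs] at this
    exact_mod_cast this
  have hxe : ∀ j, x (2 * j + 1) = x (2 * j) := fun j => by rw [(hx j).1, (hx j).2]
  have hs' : ∀ j, s (j - 1) = x (2 * j) - x (2 * j - 1) := fun j => by
    rw [hs]; congr 2 <;> ring
  have hs0 : ∀ j, s (j - 1) = x (2 * j + 1) - x (2 * j - 1) := fun j => by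
    rw [hs', hxe]
  have hs1 : ∀ j, s j = x (2 * j + 2) - x (2 * j) := fun j => by
    rw [hs, hxe]
  have he : ∀ j, K (δ (2 * j)) =
      ((-(p * s (j - 1)) : ℝ) : ℂ) • δ (2 * j - 1) + ((q * s j : ℝ) : ℂ) • δ (2 * j + 2) := by
    intro j
    refine lp.ext (funext fun i => ?_)
    have h := hK i (2 * j)
    simp only [ContinuousLinearMap.add_apply, ContinuousLinearMap.smul_apply, hB (2 * j), (hC j).1,
      coord_add', coord_sub', coord_smul', coord_δ] at h
    refine h.trans ?_
    change _ = coord _ i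
    simp only [coord_add', coord_smul', coord_δ]
    by_cases h1 : i = 2 * j - 1
    · subst h1
      rw [if_pos rfl, if_neg (by omega), if_neg (by omega), hs']
      push_cast; ring
    by_cases h2 : i = 2 * j + 2
    · subst h2
      rw [if_pos rfl, if_neg (by omega), if_neg (by omega), hs1 j]
      push_cast; ring
    by_cases h3 : i = 2 * j + 1
    · subst h3
      rw [if_pos rfl, if_neg (by omega), if_neg (by omega), hxe]
      push_cast; ring
    simp [h1, h2, h3]
  have ho : ∀ j, K (δ (2 * j + 1)) =
      ((-(q * s (j - 1)) : ℝ) : ℂ) • δ (2 * j - 1) + ((-(p * s j) : ℝ) : ℂ) • δ (2 * j + 2) := by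
    intro j
    refine lp.ext (funext fun i => ?_)
    have h := hK i (2 * j + 1)
    have e1 : 2 * j + 1 - 1 = 2 * j := by ring
    have e2 : 2 * j + 1 + 1 = 2 * j + 2 := by ring
    simp only [ContinuousLinearMap.add_apply, ContinuousLinearMap.smul_apply, hB (2 * j + 1),
      (hC j).2, coord_add', coord_sub', coord_smul', coord_δ, e1, e2] at h
    refine h.trans ?_
    change _ = coord _ i
    simp only [coord_add', coord_smul', coord_δ]
    by_cases h1 : i = 2 * j - 1
    · subst h1
      rw [if_pos rfl, if_neg (by omega), if_neg (by omega), hs0]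
      push_cast; ring
    by_cases h2 : i = 2 * j + 2
    · subst h2
      rw [if_pos rfl, if_neg (by omega), if_neg (by omega), hs j]
      push_cast; ring
    by_cases h3 : i = 2 * j
    · subst h3
      rw [if_pos rfl, if_neg (by omega), if_neg (by omega), hxe]
      push_cast; ring
    simp [h1, h2, h3]
  have hadj : (ContinuousLinearMap.adjoint K).comp K =
      ((p ^ 2 + q ^ 2 : ℝ) : ℂ) • (1 : Op) := by
    apply op_ext
    intro i j
    rw [← inner_δ, ContinuousLinearMap.comp_apply, ContinuousLinearMap.adjoint_inner_right,
      ContinuousLinearMap.smul_apply, ContinuousLinearMap.one_apply, coord_smul', coord_δ]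
    obtain ⟨a, ha | ha⟩ := Int.even_or_odd' i <;> obtain ⟨b, hb | hb⟩ := Int.even_or_odd' j <;>
      subst ha <;> subst hb <;>
      simp only [he, ho, inner_add_left, inner_smul_left, inner_δ, coord_add', coord_smul',
        coord_δ, Complex.conj_ofReal] <;>
      by_cases hab : a = b
    all_goals first
      | subst hab
        have h1 := hs2 a
        have h2 := hs2 (a - 1)
        simp only [if_true, if_neg (show ¬ (2 * a - 1 = 2 * a + 2) by omega),
          if_neg (show ¬ (2 * a + 2 = 2 * a - 1) by omega),
          if_neg (show ¬ (2 * a = 2 * a + 1) by omega),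
          if_neg (show ¬ (2 * a + 1 = 2 * a) by omega)]
        push_cast
        first
          | linear_combination (p : ℂ) ^ 2 * h2 + (q : ℂ) ^ 2 * h1
          | linear_combination (q : ℂ) ^ 2 * h2 + (p : ℂ) ^ 2 * h1
          | linear_combination (p : ℂ) * q * h2 - (p : ℂ) * q * h1
      | repeat rw [if_neg (by omega)]
        ring
  have hn : ‖K‖ * ‖K‖ = ‖((p ^ 2 + q ^ 2 : ℝ) : ℂ) • (1 : Op)‖ := by
    rw [← hadj, ContinuousLinearMap.norm_adjoint_comp_self]
  have : Nontrivial Hqw := ⟨⟨δ 0, 0, fun h => by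
    have := congrArg (fun ψ => coord ψ 0) h
    simp only [coord_δ, if_true] at this
    exact one_ne_zero this⟩⟩
  rw [norm_smul, norm_one, mul_one, Complex.norm_real, Real.norm_of_nonneg (by positivity)] at hn
  rw [sq, hn]

/-- `‖[X,B]‖ = 1`, `‖[X,C]‖ = 1`, and for every `t ∈ [0,1]`,
`‖[X, rt·B + t²·C]‖ = t` where `r = √(1-t²)`. -/
theorem stmt1 (B C : Op) (hB : IsB B) (hC : IsC C)
    (x : ℤ → ℝ) (hx : IsPos x)
    (KB KC : Op) (hKB : IsXComm x B KB) (hKC : IsXComm x C KC) :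
    ‖KB‖ = 1 ∧ ‖KC‖ = 1 ∧
      ∀ t : ℝ, t ∈ Set.Icc (0 : ℝ) 1 →
        ∀ K : Op,
          IsXComm x (((Real.sqrt (1 - t ^ 2) * t : ℝ) : ℂ) • B + ((t ^ 2 : ℝ) : ℂ) • C) K →
            ‖K‖ = t := by
  refine ⟨?_, ?_, ?_⟩
  · have h := key hB hC hx 1 0 KB (by simpa using hKB)
    exact (sq_eq_sq₀ (norm_nonneg _) zero_le_one).1 (by rw [h]; norm_num)
  · have h := key hB hC hx 0 1 KC (by simpa using hKC)
    exact (sq_eq_sq₀ (norm_nonneg _) zero_le_one).1 (by rw [h]; norm_num)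
  · intro t ht K hK
    have h := key hB hC hx _ _ K hK
    refine (sq_eq_sq₀ (norm_nonneg _) ht.1).1 ?_
    have h1 : 0 ≤ 1 - t ^ 2 := by nlinarith [ht.1, ht.2]
    rw [h, mul_pow, Real.sq_sqrt h1]
    ring
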